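/- Let n ≥ 1 and let α = (a_1,…,a_n) be an MVP parking function with outcome the decreasing permutation w_0, i.e., O_n(α) = w_0. Then every spot is preferred by at most two cars: for every j ∈ [n], |{i ∈ [n] : a_i = j}| ≤ 2. -/

import Mathlib

open Finset

namespace MVPPark

/-- One step of the MVP parking process: car `c`, preferring spot `p`, arrives at the
state `state` (recording, for each spot, the car parked there, if any).  Car `c` always
parks in spot `p`; if spot `p` was occupied by an (earlier) car `j`, then `j` is bumped
and parks in the first unoccupied spot strictly beyond `p`, if such a spot exists
(otherwise `j` drives off unparked). -/
def mvpStep {n : ℕ} (state : Fin n → Option (Fin n)) (c p : Fin n) :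
    Fin n → Option (Fin n) :=
  match state p with
  | none => Function.update state p (some c)
  | some j =>
    match (List.finRange n).find? (fun k => decide (p < k) && (state k).isNone) with
    | none => Function.update state p (some c)
    | some k => Function.update (Function.update state p (some c)) k (some j)

/-- The final state of the MVP parking process with preference list `α`:
cars `0, 1, …, n-1` enter in order, car `i` preferring spot `α i`. -/
def mvpRun {n : ℕ} (α : Fin n → Fin n) : Fin n → Option (Fin n) :=
  (List.finRange n).foldl (fun st c => mvpStep st c (α c)) (fun _ => none)

/-- `α` is an MVP parking function: under the MVP rule, all `n` cars end up parked. -/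
def IsMVP {n : ℕ} (α : Fin n → Fin n) : Prop :=
  ∀ c : Fin n, ∃ j : Fin n, mvpRun α j = some c

/-- The outcome of the MVP parking process on `α` is the permutation `π`:
for each `j`, spot `j` ends up occupied by car `π j`. -/
def MvpOutcome {n : ℕ} (α : Fin n → Fin n) (π : Equiv.Perm (Fin n)) : Prop :=
  ∀ j : Fin n, mvpRun α j = some (π j)

end MVPPark

namespace MVPPark

/-- `m_j(α)`: the number of cars preferring spot `j` under the preference list `α`. -/
def mcount {n : ℕ} (α : Fin n → Fin n) (j : Fin n) : ℕ :=
  (Finset.univ.filter (fun i => α i = j)).card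

end MVPPark

namespace MVPPark

/-- The three possible effects of one parking step: the spot was free; a car was bumped and
lost; or a car was bumped to the first free spot `k` beyond. -/
theorem mvpStep_cases {n : ℕ} (st : Fin n → Option (Fin n)) (c p : Fin n) :
    (st p = none ∧ mvpStep st c p = Function.update st p (some c)) ∨
    (∃ j, st p = some j ∧ mvpStep st c p = Function.update st p (some c)) ∨
    (∃ j k, st p = some j ∧ p < k ∧ st k = none ∧ (∀ m, p < m → m < k → st m ≠ none) ∧
      mvpStep st c p = Function.update (Function.update st p (some c)) k (some j)) := by
  unfold mvpStep
  cases hp : st p with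
  | none => left; simp
  | some j =>
    right
    cases hf : (List.finRange n).find? (fun k => decide (p < k) && (st k).isNone) with
    | none => left; exact ⟨j, rfl, by simp⟩
    | some k =>
      right
      have hk := List.find?_some hf
      simp only [Bool.and_eq_true, decide_eq_true_eq, Option.isNone_iff_eq_none] at hk
      refine ⟨j, k, rfl, hk.1, hk.2, ?_, by simp⟩
      intro m hpm hmk hm
      obtain ⟨_, as, bs, hl, has⟩ := List.find?_eq_some_iff_append.1 hf
      have hsorted : (as ++ k :: bs).Pairwise (· < ·) := hl ▸ List.pairwise_lt_finRange n
      have hmem : m ∈ as ++ k :: bs := hl ▸ List.mem_finRange m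
      rcases List.mem_append.1 hmem with h | h
      · have := has m h
        simp [hpm, hm] at this
      · rcases List.mem_cons.1 h with h | h
        · exact absurd h hmk.ne
        · have := (List.pairwise_cons.1 (List.pairwise_append.1 hsorted).2.1).1 m h
          exact absurd this hmk.not_gt

/-- The state of the street after the first `t` cars have entered. -/
def stateAt {n : ℕ} (α : Fin n → Fin n) : ℕ → Fin n → Option (Fin n)
  | 0 => fun _ => none
  | t + 1 => if h : t < n then mvpStep (stateAt α t) ⟨t, h⟩ (α ⟨t, h⟩) else stateAt α t

theorem stateAt_succ {n : ℕ} (α : Fin n → Fin n) (c : Fin n) :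
    stateAt α (c + 1) = mvpStep (stateAt α c) c (α c) := by
  simp [stateAt]

theorem foldl_take_eq_stateAt {n : ℕ} (α : Fin n → Fin n) (t : ℕ) :
    ((List.finRange n).take t).foldl (fun st c => mvpStep st c (α c)) (fun _ => none) =
      stateAt α t := by
  induction t with
  | zero => simp [stateAt]
  | succ t ih =>
    by_cases h : t < n
    · rw [List.take_succ_eq_append_getElem (by simpa using h), List.foldl_append, ih]
      simp [stateAt, h]
    · rw [List.take_of_length_le (by simp; omega)] at ih ⊢
      simpa [stateAt, h] using ih

theorem mvpRun_eq_stateAt {n : ℕ} (α : Fin n → Fin n) : mvpRun α = stateAt α n := by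
  rw [← foldl_take_eq_stateAt, List.take_of_length_le (by simp), mvpRun]

theorem stateAt_lt_and_inj {n : ℕ} (α : Fin n → Fin n) (t : ℕ) :
    (∀ p i, stateAt α t p = some i → (i : ℕ) < t) ∧
    ∀ p q i, stateAt α t p = some i → stateAt α t q = some i → p = q := by
  induction t with
  | zero => simp [stateAt]
  | succ t ih =>
    by_cases h : t < n
    · obtain ⟨hlt, hinj⟩ := ih
      have hs := stateAt_succ α ⟨t, h⟩
      simp only at hs
      rw [hs]
      generalize hc : (⟨t, h⟩ : Fin n) = c
      have hct : (c : ℕ) = t := by rw [← hc]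
      generalize stateAt α t = st at hlt hinj ⊢
      generalize α c = r
      have hcs : ∀ p, st p ≠ some c := fun p hp => by have := hlt p c hp; omega
      rcases mvpStep_cases st c r with ⟨-, e⟩ | ⟨j, -, e⟩ | ⟨j, k, hj, hk, hkn, -, e⟩ <;>
        rw [e] <;> simp only [Function.update_apply] <;> constructor <;> grind
    · simp only [stateAt, h, dite_false]
      exact ⟨fun p i hp => (ih.1 p i hp).trans (Nat.lt_succ_self t), ih.2⟩

theorem stateAt_ne_none_of_le {n : ℕ} (α : Fin n → Fin n) (p : Fin n) {s t : ℕ} (hst : s ≤ t)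
    (hs : stateAt α s p ≠ none) : stateAt α t p ≠ none := by
  induction t, hst using Nat.le_induction with
  | base => exact hs
  | succ t _ ih =>
    by_cases h : t < n
    · have e := stateAt_succ α ⟨t, h⟩
      simp only at e
      rw [e]
      rcases mvpStep_cases (stateAt α t) ⟨t, h⟩ (α ⟨t, h⟩) with
        ⟨-, e⟩ | ⟨j, -, e⟩ | ⟨j, k, -, -, -, -, e⟩ <;>
        rw [e] <;> simp only [Function.update_apply] <;> grind
    · simpa [stateAt, h] using ih

theorem stateAt_succ_self_ne_none {n : ℕ} (α : Fin n → Fin n) (c : Fin n) :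
    stateAt α (c + 1) (α c) ≠ none := by
  rw [stateAt_succ]
  rcases mvpStep_cases (stateAt α c) c (α c) with
    ⟨-, e⟩ | ⟨j, -, e⟩ | ⟨j, k, -, -, -, -, e⟩ <;>
    rw [e] <;> simp only [Function.update_apply] <;> grind

/-- The shape of the street after `t` cars have entered, when the final outcome is decreasing:
all `t` cars are parked, each of them either in its final spot or among the first `n - t` spots,
and the cars in the first `n - t` spots increase from left to right. -/
structure Descending {n : ℕ} (t : ℕ) (st : Fin n → Option (Fin n)) : Prop where
  exists_spot : ∀ i : Fin n, (i : ℕ) < t → ∃ p, st p = some i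
  eq_rev_or_lt : ∀ p i, st p = some i → p = i.rev ∨ (p : ℕ) + t < n
  lt_of_lt : ∀ p q i j : Fin n, p < q → (q : ℕ) + t < n → st p = some i → st q = some j → i < j

theorem Descending.of_step {n : ℕ} {st : Fin n → Option (Fin n)} {c r : Fin n}
    (hlt : ∀ p i, st p = some i → i < c)
    (hinj : ∀ p q i, st p = some i → st q = some i → p = q)
    (h : Descending (c + 1) (mvpStep st c r)) :
    Descending c st ∧ (r = c.rev ∨ st r = none) := by
  obtain ⟨hex, hrev, hmono⟩ := h
  have rev_val : ∀ i : Fin n, (i.rev : ℕ) + i + 1 = n := fun i => by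
    rw [Fin.val_rev]; omega
  have hex' : ∀ i : Fin n, (i : ℕ) < c → ∃ p, st p = some i := by
    intro i hi
    obtain ⟨p, hp⟩ := hex i (by omega)
    have hic : i ≠ c := fun hic => by simp [hic] at hi
    clear hex hrev hmono rev_val hinj hlt
    rcases mvpStep_cases st c r with ⟨-, e⟩ | ⟨j, -, e⟩ | ⟨j, k, hj, hk, hkn, -, e⟩ <;>
      rw [e] at hp <;> simp only [Function.update_apply] at hp <;> grind
  rcases mvpStep_cases st c r with ⟨hr, e⟩ | ⟨j, hj, e⟩ | ⟨j, k, hj, hk, hkn, hfirst, e⟩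
  · have keep : ∀ q i, st q = some i → mvpStep st c r q = some i := by
      intro q i hq
      rw [e, Function.update_apply]
      grind
    have key : ∀ q i, st q = some i → q = i.rev ∨ (q : ℕ) + (c + 1) < n :=
      fun q i hq => hrev q i (keep q i hq)
    refine ⟨⟨hex', fun q i hq => (key q i hq).imp_right (by omega), ?_⟩, Or.inr hr⟩
    intro p q i j hpq hqn hp hq
    refine hmono p q i j hpq ?_ (keep _ _ hp) (keep _ _ hq)
    rcases key q j hq with h | h
    · have := hlt q j hq
      have := rev_val j
      rw [← h] at this
      omega
    · exact h
  · exfalso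
    have hjc := hlt r j hj
    obtain ⟨q, hq⟩ := hex j (by omega)
    rw [e, Function.update_apply] at hq
    split_ifs at hq with hqr
    · simp only [Option.some.injEq] at hq
      exact hjc.ne hq.symm
    · exact hqr (hinj q r j hq hj)
  · have keep : ∀ q i, q ≠ r → st q = some i → mvpStep st c r q = some i := by
      intro q i hqr hq
      rw [e, Function.update_apply, Function.update_apply]
      grind
    have hr' : mvpStep st c r r = some c := by
      rw [e, Function.update_apply, Function.update_apply]
      grind
    have hk' : mvpStep st c r k = some j := by
      rw [e, Function.update_self]
    have hjc := hlt r j hj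
    have hkj : k = j.rev := by
      rcases hrev k j hk' with h | h
      · exact h
      · exact absurd (hmono r k c j hk h hr' hk') hjc.not_gt
    have final : ∀ q i, q ≠ r → st q = some i → ¬ (q : ℕ) + (c + 1) < n → q = i.rev :=
      fun q i hqr hq hn => (hrev q i (keep q i hqr hq)).resolve_right hn
    have hcv := rev_val c
    have hjv := rev_val j
    rw [← hkj] at hjv
    have hrc : r = c.rev := by
      rcases hrev r c hr' with h | h
      · exact h
      · exfalso
        obtain ⟨i, hi⟩ := Option.ne_none_iff_exists'.1
          (hfirst c.rev (by rw [Fin.lt_def]; omega) (by rw [Fin.lt_def]; omega))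
        have h1 := final c.rev i (by rw [Ne, Fin.ext_iff]; omega) hi (by omega)
        exact (hlt _ i hi).ne (Fin.rev_injective h1).symm
    rw [← hrc] at hcv
    refine ⟨⟨hex', ?_, ?_⟩, Or.inl hrc⟩
    · intro q i hq
      by_cases hqr : q = r
      · right; subst hqr; omega
      · exact (hrev q i (keep q i hqr hq)).imp_right (by omega)
    · intro p q i j' hpq hqn hp hq
      rw [Fin.lt_def] at hpq
      have hpr : p ≠ r := by rw [Ne, Fin.ext_iff]; omega
      by_cases hqr : q = r
      · subst hqr
        obtain rfl : j = j' := by simpa [hj] using hq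
        by_contra hij
        have hne : i ≠ j := fun hij => hpr (hinj p q i hp (hij ▸ hj))
        have hji : j < i := lt_of_le_of_ne (not_lt.1 hij) hne.symm
        have hic := hlt p i hp
        have hiv := rev_val i
        obtain ⟨m, hm⟩ := Option.ne_none_iff_exists'.1
          (hfirst i.rev (by rw [Fin.lt_def]; omega) (by rw [Fin.lt_def]; omega))
        have h1 := final i.rev m (by rw [Ne, Fin.ext_iff]; omega) hm (by omega)
        obtain rfl := Fin.rev_injective h1
        have := hinj p _ i hp hm
        rw [Fin.ext_iff] at this
        omega
      · have : (q : ℕ) ≠ r := fun h => hqr (Fin.ext h)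
        exact hmono p q i j' hpq (by omega) (keep p i hpr hp) (keep q j' hqr hq)

theorem descending_stateAt {n : ℕ} {α : Fin n → Fin n}
    (h : ∀ j : Fin n, mvpRun α j = some j.rev) {t : ℕ} (ht : t ≤ n) :
    Descending t (stateAt α t) := by
  induction ht using Nat.decreasingInduction with
  | self =>
    rw [← mvpRun_eq_stateAt]
    refine ⟨fun i _ => ⟨i.rev, by simp [h]⟩, fun p i hp => ?_, fun p q i j _ hq => by omega⟩
    rw [h, Option.some.injEq] at hp
    left; simp [← hp]
  | of_succ t ht ih =>
    obtain ⟨hlt, hinj⟩ := stateAt_lt_and_inj α t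
    have e := stateAt_succ α ⟨t, ht⟩
    simp only at e
    rw [e] at ih
    exact (Descending.of_step (c := ⟨t, ht⟩) hlt hinj ih).1

/-- When the outcome is decreasing, every car prefers its final spot or a spot that is free on
its arrival. -/
theorem eq_rev_or_stateAt_eq_none {n : ℕ} {α : Fin n → Fin n}
    (h : ∀ j : Fin n, mvpRun α j = some j.rev) (c : Fin n) :
    α c = c.rev ∨ stateAt α c (α c) = none := by
  obtain ⟨hlt, hinj⟩ := stateAt_lt_and_inj α c
  have hd := descending_stateAt h (t := c + 1) c.isLt
  rw [stateAt_succ] at hd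
  exact (Descending.of_step hlt hinj hd).2

end MVPPark

open MVPPark in
/-- If the outcome of `α` is the decreasing permutation `w₀`, then every spot is
preferred by at most two cars. -/
theorem at_most_two_prefer (n : ℕ) (hn : 1 ≤ n) (α : Fin n → Fin n)
    (h : ∀ j : Fin n, mvpRun α j = some j.rev) :
    ∀ j : Fin n, mcount α j ≤ 2 := by
  intro j
  unfold mcount
  have hsub : univ.filter (fun i => α i = j) ⊆
      insert j.rev (univ.filter (fun i => α i = j ∧ stateAt α i j = none)) := by
    intro i hi
    simp only [mem_filter, mem_univ, true_and, mem_insert] at hi ⊢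
    subst hi
    rcases eq_rev_or_stateAt_eq_none h i with h1 | h1
    · left; simp [h1]
    · exact Or.inr ⟨rfl, h1⟩
  have hone : (univ.filter (fun i => α i = j ∧ stateAt α i j = none)).card ≤ 1 := by
    rw [card_le_one]
    have hle : ∀ a b : Fin n, α a = j → stateAt α b j = none → b ≤ a := by
      intro a b ha hb
      by_contra hab
      refine stateAt_ne_none_of_le α j (s := a + 1) (t := b) ?_ ?_ hb
      · exact not_le.1 hab
      · exact ha ▸ stateAt_succ_self_ne_none α a
    intro a ha b hb
    simp only [mem_filter, mem_univ, true_and] at ha hb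
    exact le_antisymm (hle b a hb.1 ha.2) (hle a b ha.1 hb.2)
  calc _ ≤ _ := card_le_card hsub
    _ ≤ _ := card_insert_le _ _
    _ ≤ 2 := by omega
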